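/- Let Z₁,…,Z_r be i.i.d. standard normal random variables, let w₁,…,w_r ≥ 0 satisfy ∑_{i=1}^r w_i = 1, and set Y = ∑_{i=1}^r w_i·Z_i². Then for all s ∈ (0,1), Pr[Y ≤ s] ≤ √s · e^{(1−s)/2}. -/

import Mathlib

open MeasureTheory ProbabilityTheory Real

theorem Finset.one_add_sum_le_prod_one_add_of_nonneg {ι : Type*} (s : Finset ι) (a : ι → ℝ)
    (ha : ∀ i, 0 ≤ a i) : 1 + ∑ i ∈ s, a i ≤ ∏ i ∈ s, (1 + a i) := by
  classical
  induction s using Finset.induction_on with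
  | empty => simp
  | insert i s hi ih =>
    rw [Finset.sum_insert hi, Finset.prod_insert hi]
    nlinarith [mul_le_mul_of_nonneg_left ih (ha i),
      mul_nonneg (ha i) (Finset.sum_nonneg fun j (_ : j ∈ s) => ha j)]

/-- The Laplace transform of the square of a standard normal variable. -/
theorem integral_exp_neg_mul_sq_gaussianReal {a : ℝ} (ha : 0 ≤ a) :
    ∫ x, exp (-a * x ^ 2) ∂(gaussianReal 0 1) = (√(1 + 2 * a))⁻¹ := by
  have hmul : ∀ x : ℝ, gaussianPDFReal 0 1 x • exp (-a * x ^ 2)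
      = (√(2 * π))⁻¹ * exp (-(1 / 2 + a) * x ^ 2) := by
    intro x
    simp only [gaussianPDFReal, smul_eq_mul, NNReal.coe_one, mul_one, sub_zero]
    rw [mul_assoc, ← exp_add]
    ring_nf
  rw [integral_gaussianReal_eq_integral_smul one_ne_zero]
  simp_rw [hmul]
  rw [integral_const_mul, integral_gaussian, ← sqrt_inv, ← sqrt_inv, ← sqrt_mul (by positivity)]
  congr 1
  have : 1 + 2 * a ≠ 0 := by positivity
  field_simp

theorem integrable_exp_neg_mul_sq_of_isFiniteMeasure {μ : Measure ℝ} [IsFiniteMeasure μ] {a : ℝ} (ha : 0 ≤ a) :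
    Integrable (fun x => exp (-a * x ^ 2)) μ := by
  refine Integrable.of_bound (by fun_prop) 1 (ae_of_all _ fun x => ?_)
  rw [norm_of_nonneg (exp_pos _).le, exp_le_one_iff]
  nlinarith [mul_nonneg ha (sq_nonneg x)]

theorem exp_neg_mul_sum_mul_sq {ι : Type*} [Fintype ι] (t : ℝ) (w x : ι → ℝ) :
    exp (-t * ∑ i, w i * x i ^ 2) = ∏ i, exp (-(t * w i) * x i ^ 2) := by
  rw [← exp_sum, Finset.mul_sum]
  simp only [neg_mul, mul_assoc]

theorem integrable_exp_neg_mul_sum_mul_sq {ι : Type*} [Fintype ι] {w : ι → ℝ}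
    (hw : ∀ i, 0 ≤ w i) {t : ℝ} (ht : 0 ≤ t) :
    Integrable (fun x : ι → ℝ => exp (-t * ∑ i, w i * x i ^ 2))
      (Measure.pi fun _ => gaussianReal 0 1) := by
  simp_rw [exp_neg_mul_sum_mul_sq]
  exact Integrable.fintype_prod (f := fun i y => exp (-(t * w i) * y ^ 2))
    fun i => integrable_exp_neg_mul_sq_of_isFiniteMeasure (mul_nonneg ht (hw i))

/-- The moment generating function of a weighted chi-square variable at a nonpositive point. -/
theorem mgf_sum_mul_sq_pi_gaussianReal {ι : Type*} [Fintype ι] {w : ι → ℝ}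
    (hw : ∀ i, 0 ≤ w i) {t : ℝ} (ht : 0 ≤ t) :
    mgf (fun x : ι → ℝ => ∑ i, w i * x i ^ 2) (Measure.pi fun _ => gaussianReal 0 1) (-t)
      = ∏ i, (√(1 + 2 * (t * w i)))⁻¹ := by
  simp_rw [mgf, exp_neg_mul_sum_mul_sq]
  rw [integral_fintype_prod_eq_prod (f := fun i y => exp (-(t * w i) * y ^ 2))]
  exact Finset.prod_congr rfl fun i _ =>
    integral_exp_neg_mul_sq_gaussianReal (mul_nonneg ht (hw i))

theorem mgf_sum_mul_sq_pi_gaussianReal_le {ι : Type*} [Fintype ι] {w : ι → ℝ}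
    (hw : ∀ i, 0 ≤ w i) (hw1 : ∑ i, w i = 1) {t : ℝ} (ht : 0 ≤ t) :
    mgf (fun x : ι → ℝ => ∑ i, w i * x i ^ 2) (Measure.pi fun _ => gaussianReal 0 1) (-t)
      ≤ (√(1 + 2 * t))⁻¹ := by
  have hnonneg : ∀ i, 0 ≤ 2 * (t * w i) := fun i => by have := hw i; positivity
  rw [mgf_sum_mul_sq_pi_gaussianReal hw ht, Finset.prod_inv_distrib,
    ← sqrt_prod _ fun i _ => by linarith [hnonneg i]]
  have h := Finset.univ.one_add_sum_le_prod_one_add_of_nonneg _ hnonneg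
  rw [← Finset.mul_sum, ← Finset.mul_sum, hw1, mul_one] at h
  gcongr

/-- **Anti-concentration of weighted chi-square.** Let `Z₁,…,Z_r` be i.i.d. standard normal
random variables, let `w₁,…,w_r ≥ 0` with `∑ᵢ wᵢ = 1`, and set `Y = ∑ᵢ wᵢ Zᵢ²`. Then for all
`s ∈ (0,1)`, `Pr[Y ≤ s] ≤ √s · e^{(1−s)/2}`. -/
theorem weighted_chi_square_lower_tail
    {Ω : Type*} [MeasurableSpace Ω] (P : Measure Ω) [IsProbabilityMeasure P]
    (r : ℕ) (Z : Ω → Fin r → ℝ)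
    (hZ : Measure.map (fun ω => Z ω) P = Measure.pi fun _ : Fin r => gaussianReal 0 1)
    (w : Fin r → ℝ) (hw : ∀ i, 0 ≤ w i) (hw1 : ∑ i, w i = 1)
    (s : ℝ) (hs : s ∈ Set.Ioo (0 : ℝ) 1) :
    P {ω | ∑ i, w i * (Z ω i) ^ 2 ≤ s} ≤ ENNReal.ofReal (Real.sqrt s * Real.exp ((1 - s) / 2)) := by
  obtain ⟨hs0, hs1⟩ := hs
  have hZm : AEMeasurable Z P := AEMeasurable.of_map_ne_zero (by
    rw [hZ]
    exact IsProbabilityMeasure.ne_zero _)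
  have hmeas : MeasurableSet {x : Fin r → ℝ | ∑ i, w i * x i ^ 2 ≤ s} :=
    measurableSet_le (by fun_prop) measurable_const
  have hmap : P {ω | ∑ i, w i * (Z ω i) ^ 2 ≤ s}
      = (Measure.pi fun _ : Fin r => gaussianReal 0 1) {x | ∑ i, w i * x i ^ 2 ≤ s} := by
    rw [← hZ, Measure.map_apply_of_aemeasurable hZm hmeas, Set.preimage_ofPred_eq]
  rw [hmap, ← ofReal_measureReal]
  refine ENNReal.ofReal_le_ofReal ?_
  -- The optimal Chernoff parameter, for which `1 + 2 * t = s⁻¹`.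
  set t := (1 - s) / (2 * s) with ht_def
  have ht : 0 ≤ t := div_nonneg (by linarith) (by linarith)
  have hts : t * s = (1 - s) / 2 := by rw [ht_def]; field_simp
  have h1t : 1 + 2 * t = s⁻¹ := by rw [ht_def]; field_simp; ring
  have hmgf := mgf_sum_mul_sq_pi_gaussianReal_le hw hw1 ht
  rw [h1t, sqrt_inv, inv_inv] at hmgf
  refine (measure_le_le_exp_mul_mgf s (neg_nonpos.2 ht)
    (integrable_exp_neg_mul_sum_mul_sq hw ht)).trans ?_
  rw [neg_neg, hts, mul_comm]
  gcongr
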